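/- The cycle C_5 on five vertices (vertex set {0,1,2,3,4} with edges between i and i+1 (mod 5)) is not a ZV-line graph: there is no sequence of nonempty vertex sets ⟨Z, V_1, …, V_k⟩ with an order on Z such that C_5 is a ZV-line graph w.r.t. ⟨Z, V_1, …, V_k⟩. -/

import Mathlib

/- Common framework: finite connected simple graphs, shortest-path distance,
   profiles as lists of vertices, mechanisms as functions `List α → α`,
   anonymity, Pareto optimality, and group-manipulation-resistance. -/

open Classical

noncomputable section

/-- The ball of radius `r` around `v`. -/
def ball {α : Type} (G : SimpleGraph α) (v : α) (r : ℕ) : Set α :=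
  {u | G.dist v u ≤ r}

/-- Distance from a vertex to a (nonempty) set of vertices. -/
def distToSet {α : Type} (G : SimpleGraph α) (v : α) (Z : Finset α) : ℕ :=
  sInf ((fun z => G.dist v z) '' (Z : Set α))

/-- An agent located at `ℓ` weakly prefers `a` over `b`. -/
def wPref {α : Type} (G : SimpleGraph α) (ℓ a b : α) : Prop := G.dist ℓ a ≤ G.dist ℓ b

/-- An agent located at `ℓ` strictly prefers `a` over `b`. -/
def sPref {α : Type} (G : SimpleGraph α) (ℓ a b : α) : Prop := G.dist ℓ a < G.dist ℓ b

/-- `u` Pareto dominates `v` w.r.t. the profile `x`. -/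
def Dominates {α : Type} (G : SimpleGraph α) (x : List α) (u v : α) : Prop :=
  (∀ a ∈ x, wPref G a u v) ∧ (∃ a ∈ x, sPref G a u v)

/-- The set of Pareto optimal locations for a profile `x`. -/
def PO {α : Type} (G : SimpleGraph α) (x : List α) : Set α :=
  {v | ¬ ∃ u, Dominates G x u v}

/-- A mechanism is anonymous if its outcome is invariant under permutations of ballots. -/
def Anonymous {α : Type} (F : List α → α) : Prop :=
  ∀ x y : List α, x.Perm y → F x = F y

/-- A mechanism is Pareto optimal if its outcome is always Pareto optimal. -/
def ParetoOptimal {α : Type} (G : SimpleGraph α) (F : List α → α) : Prop :=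
  ∀ x : List α, F x ∈ PO G x

/-- The list of ballots `x j` for agents `j` outside the coalition `C`. -/
def profileMinus {α : Type} {n : ℕ} (x : Fin n → α) (C : Finset (Fin n)) : List α :=
  ((List.finRange n).filter (fun i => decide (i ∉ C))).map x

/-- Group-manipulation-resistance where all sincere ballots and all manipulated
ballots are required to lie in the set `S`. -/
def GMRon {α : Type} (G : SimpleGraph α) (S : Set α) (F : List α → α) : Prop :=
  ¬ ∃ (n : ℕ) (x : Fin n → α) (C : Finset (Fin n)) (A : List α),
      (∀ i, x i ∈ S) ∧ (∀ a ∈ A, a ∈ S) ∧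
      (∀ i ∈ C, wPref G (x i) (F (A ++ profileMinus x C)) (F (List.ofFn x))) ∧
      (∃ i ∈ C, sPref G (x i) (F (A ++ profileMinus x C)) (F (List.ofFn x)))

/-- Group-manipulation-resistance: no coalition `C` can, by replacing its ballots
with an arbitrary finite tuple `A` of ballots (misreporting, false-name voting,
or abstaining), obtain an outcome that all its members weakly prefer and at least
one member strictly prefers. -/
def GMR {α : Type} (G : SimpleGraph α) (F : List α → α) : Prop :=
  ¬ ∃ (n : ℕ) (x : Fin n → α) (C : Finset (Fin n)) (A : List α),
      (∀ i ∈ C, wPref G (x i) (F (A ++ profileMinus x C)) (F (List.ofFn x))) ∧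
      (∃ i ∈ C, sPref G (x i) (F (A ++ profileMinus x C)) (F (List.ofFn x)))

/-- `A` is an interval in `Z` (w.r.t. the order injection `ord`): it is a subset
of `Z` that is order-convex within `Z`. -/
def IsIntervalIn {α : Type} (ord : α → ℝ) (Z : Finset α) (A : Set α) : Prop :=
  A ⊆ (Z : Set α) ∧
  ∀ a ∈ A, ∀ b ∈ A, ∀ c ∈ Z, ord a ≤ ord c → ord c ≤ ord b → c ∈ A

/-- A ZV-ordered partition ⟨Z, V₁, …, V_k⟩ of a connected graph `G`, together with
the order (injection into ℝ) on `Z` and the roots of the `Vᵢ`. -/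
structure ZVPartition {α : Type} (G : SimpleGraph α) where
  hconn : G.Connected
  k : ℕ
  Z : Finset α
  Vs : Fin k → Finset α
  ord : α → ℝ
  Z_nonempty : Z.Nonempty
  Vs_nonempty : ∀ i, (Vs i).Nonempty
  ord_inj : Set.InjOn ord (Z : Set α)
  Vs_disjoint : ∀ i j, i ≠ j → Disjoint (Vs i) (Vs j)
  cover : ∀ v : α, v ∈ Z ∨ ∃ i, v ∈ Vs i
  no_drop_Z : ¬ ∀ v : α, ∃ i, v ∈ Vs i
  no_drop_Vs : ∀ i : Fin k, ¬ ∀ v : α, v ∈ Z ∨ ∃ j, j ≠ i ∧ v ∈ Vs j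
  root : Fin k → α
  root_mem : ∀ i, root i ∈ Vs i
  root_min : ∀ i, ∀ u ∈ Vs i, distToSet G (root i) Z ≤ distToSet G u Z
  root_unique : ∀ i, ∀ u ∈ Vs i, (∀ w ∈ Vs i, distToSet G u Z ≤ distToSet G w Z) → u = root i
  separation : ∀ i : Fin k, ∀ u ∈ Vs i, ∀ v : α, v ∉ Vs i →
      ∀ p : G.Walk u v, root i ∈ p.support ∧ ∃ z ∈ Z, z ∈ p.support

/-- `G` is a ZV-line graph w.r.t. the ZV-ordered partition `P`: balls of radius 1
around Z-vertices meet `Z` in intervals, each induced subgraph on `Vᵢ` is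
recursively a ZV-line graph whose Z-set contains the root of `Vᵢ` as its leftmost
element, and balls of radius 1 around the roots meet `Z` in intervals. -/
inductive IsZVLineGraph : {β : Type} → {H : SimpleGraph β} → ZVPartition H → Prop
  | mk {β : Type} {H : SimpleGraph β} (P : ZVPartition H)
      (hb : ∀ z ∈ P.Z, IsIntervalIn P.ord P.Z (ball H z 1 ∩ (P.Z : Set β)))
      (Q : ∀ i : Fin P.k, ZVPartition (H.induce ((P.Vs i : Finset β) : Set β)))
      (hQ : ∀ i, IsZVLineGraph (Q i))
      (hroot : ∀ i : Fin P.k, ∃ h : P.root i ∈ ((P.Vs i : Finset β) : Set β),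
          (⟨P.root i, h⟩ : ((P.Vs i : Finset β) : Set β)) ∈ (Q i).Z ∧
          ∀ z ∈ (Q i).Z, (Q i).ord ⟨P.root i, h⟩ ≤ (Q i).ord z)
      (hballroot : ∀ i, IsIntervalIn P.ord P.Z (ball H (P.root i) 1 ∩ (P.Z : Set β))) :
      IsZVLineGraph P

/-- The cycle graph on `ZMod n`: vertices `i` and `i + 1` (mod `n`) are adjacent. -/
def cycleG (n : ℕ) : SimpleGraph (ZMod n) :=
  SimpleGraph.fromRel (fun a b => b = a + 1)

theorem cycleG_five_adj_iff (x y : ZMod 5) :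
    (cycleG 5).Adj x y ↔ y = x + 1 ∨ x = y + 1 := by
  rw [cycleG, SimpleGraph.fromRel_adj]
  revert x y
  decide

theorem mem_unitBall_iff {α : Type} {G : SimpleGraph α} (hG : G.Connected) (x y : α) :
    y ∈ ball G x 1 ↔ x = y ∨ G.Adj x y := by
  rw [← hG.dist_eq_zero_iff, ← SimpleGraph.dist_eq_one_iff_adj]
  change G.dist x y ≤ 1 ↔ _
  omega

theorem mem_ball_cycleG_five_iff (hG : (cycleG 5).Connected) (x y : ZMod 5) :
    y ∈ ball (cycleG 5) x 1 ↔ x = y ∨ y = x + 1 ∨ x = y + 1 := by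
  rw [mem_unitBall_iff hG, cycleG_five_adj_iff]

/-- An edge leaving `Vᵢ` starts at the root of `Vᵢ`. -/
theorem ZVPartition.eq_root_of_adj {α : Type} {G : SimpleGraph α} (P : ZVPartition G)
    {i : Fin P.k} {u v : α} (hu : u ∈ P.Vs i) (hv : v ∉ P.Vs i) (h : G.Adj u v) :
    u = P.root i := by
  have hr := (P.separation i u hu v hv h.toWalk).1
  have hm := P.root_mem i
  simp only [SimpleGraph.Walk.support_cons, SimpleGraph.Walk.support_nil, List.mem_cons,
    List.not_mem_nil, or_false] at hr
  rcases hr with hr | hr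
  · exact hr.symm
  · exact absurd (hr ▸ hm) hv

/-- An edge leaving `Vᵢ` meets `Z`. -/
theorem ZVPartition.mem_Z_of_adj {α : Type} {G : SimpleGraph α} (P : ZVPartition G)
    {i : Fin P.k} {u v : α} (hu : u ∈ P.Vs i) (hv : v ∉ P.Vs i) (h : G.Adj u v) :
    u ∈ P.Z ∨ v ∈ P.Z := by
  obtain ⟨z, hz, hzs⟩ := (P.separation i u hu v hv h.toWalk).2
  simp only [SimpleGraph.Walk.support_cons, SimpleGraph.Walk.support_nil, List.mem_cons,
    List.not_mem_nil, or_false] at hzs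
  rcases hzs with rfl | rfl
  · exact Or.inl hz
  · exact Or.inr hz

/-- In `C₅` every part `Vᵢ` consists of its root only, as `C₅` has no cut vertex. -/
theorem ZVPartition.eq_root_of_mem_cycleG_five (P : ZVPartition (cycleG 5)) {i : Fin P.k}
    {u : ZMod 5} (hu : u ∈ P.Vs i) : u = P.root i := by
  by_contra hne
  have hstep : ∀ x ∈ P.Vs i, x ≠ P.root i → x + 1 ∈ P.Vs i ∧ x - 1 ∈ P.Vs i := by
    intro x hx hxr
    constructor
    · by_contra h
      exact hxr (P.eq_root_of_adj hx h ((cycleG_five_adj_iff _ _).2 (Or.inl rfl)))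
    · by_contra h
      exact hxr (P.eq_root_of_adj hx h ((cycleG_five_adj_iff _ _).2 (Or.inr (by ring))))
  have hclosed : ∀ (p : ZMod 5 → Bool) (r x : ZMod 5), p r = true → p x = true → x ≠ r →
      (∀ y, p y = true → y ≠ r → p (y + 1) = true ∧ p (y - 1) = true) → ∀ v, p v = true := by
    intro p r x hr hx hxr h v
    have key : ∀ r x v : ZMod 5, x ≠ r → v = r ∨ v = x ∨
        (v = x + 1 ∨ (x + 1 ≠ r ∧ (v = x + 1 + 1 ∨ (x + 1 + 1 ≠ r ∧ v = x + 1 + 1 + 1)))) ∨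
        (v = x - 1 ∨ (x - 1 ≠ r ∧ (v = x - 1 - 1 ∨ (x - 1 - 1 ≠ r ∧ v = x - 1 - 1 - 1)))) := by
      decide
    have h1 := h x hx hxr
    rcases key r x v hxr with rfl | rfl | (rfl | ⟨n1, rfl | ⟨n2, rfl⟩⟩) |
      (rfl | ⟨n1, rfl | ⟨n2, rfl⟩⟩)
    · exact hr
    · exact hx
    · exact h1.1
    · exact (h _ h1.1 n1).1
    · exact (h _ (h _ h1.1 n1).1 n2).1
    · exact h1.2
    · exact (h _ h1.2 n1).2
    · exact (h _ (h _ h1.2 n1).2 n2).2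
  refine P.no_drop_Z fun v => ⟨i, ?_⟩
  simpa using hclosed (fun y => decide (y ∈ P.Vs i)) (P.root i) u (by simpa using P.root_mem i)
    (by simpa using hu) hne (by simpa using hstep) v

theorem ZVPartition.mem_Z_or_mem_Z_cycleG_five (P : ZVPartition (cycleG 5)) (x : ZMod 5) :
    x ∈ P.Z ∨ x + 1 ∈ P.Z := by
  rcases P.cover x with hx | ⟨i, hi⟩
  · exact Or.inl hx
  · have hadj : (cycleG 5).Adj x (x + 1) := (cycleG_five_adj_iff _ _).2 (Or.inl rfl)
    refine P.mem_Z_of_adj hi (fun h => hadj.ne ?_) hadj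
    exact (P.eq_root_of_mem_cycleG_five hi).trans (P.eq_root_of_mem_cycleG_five h).symm

/-- No order on a vertex cover `Z` of `C₅` makes the trace on `Z` of every ball of radius one
an interval. -/
theorem not_forall_isIntervalIn_ball_cycleG_five (hG : (cycleG 5).Connected)
    (Z : Finset (ZMod 5)) (hne : Z.Nonempty) (ord : ZMod 5 → ℝ)
    (hcover : ∀ x, x ∈ Z ∨ x + 1 ∈ Z) :
    ¬ ∀ x, IsIntervalIn ord Z (ball (cycleG 5) x 1 ∩ (Z : Set (ZMod 5))) := by
  intro hI
  have hb := mem_ball_cycleG_five_iff hG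
  have hbetween : ∀ x a b c : ZMod 5, a ∈ Z → b ∈ Z → c ∈ Z →
      (x = a ∨ a = x + 1 ∨ x = a + 1) → (x = b ∨ b = x + 1 ∨ x = b + 1) →
      ¬ (x = c ∨ c = x + 1 ∨ x = c + 1) → ord a ≤ ord c → ord b < ord c := by
    intro x a b c ha hb' hc hxa hxb hxc hac
    by_contra! hcb
    exact hxc ((hb x c).1 ((hI x).2 a ⟨(hb x a).2 hxa, ha⟩ b ⟨(hb x b).2 hxb, hb'⟩ c hc hac hcb).1)
  obtain ⟨m, hm, hmin⟩ := Z.exists_min_image ord hne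
  have h1 := hcover (m + 1)
  have h2 := hcover (m + 2)
  have h3 := hcover (m + 3)
  rw [show m + 1 + 1 = m + 2 by ring] at h1
  rw [show m + 2 + 1 = m + 3 by ring] at h2
  rw [show m + 3 + 1 = m + 4 by ring] at h3
  have f2 (c : ZMod 5) (hc : c ∈ Z) (h : c = m + 3 ∨ c = m + 4) (h2 : m + 2 ∈ Z) :
      ord (m + 2) < ord c := by
    refine hbetween (m + 1) m (m + 2) c hm h2 hc ?_ ?_ ?_ (hmin c hc)
    · clear * -; revert m; decide
    · clear * -; revert m; decide
    · clear * - h; revert m c; decide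
  have f3 (c : ZMod 5) (hc : c ∈ Z) (h : c = m + 1 ∨ c = m + 2) (h3 : m + 3 ∈ Z) :
      ord (m + 3) < ord c := by
    refine hbetween (m + 4) m (m + 3) c hm h3 hc ?_ ?_ ?_ (hmin c hc)
    · clear * -; revert m; decide
    · clear * -; revert m; decide
    · clear * - h; revert m c; decide
  have f0 (b c : ZMod 5) (hb : b ∈ Z) (hc : c ∈ Z) (h : b = m + 1 ∨ b = m + 4)
      (h' : c = m + 2 ∨ c = m + 3) : ord b < ord c := by
    refine hbetween m m b c hm hb hc (Or.inl rfl) ?_ ?_ (hmin c hc)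
    · clear * - h; revert m b; decide
    · clear * - h'; revert m c; decide
  by_cases z2 : m + 2 ∈ Z
  · by_cases z3 : m + 3 ∈ Z
    · exact lt_asymm (f2 _ z3 (Or.inl rfl) z2) (f3 _ z2 (Or.inr rfl) z3)
    · have z4 := h3.resolve_left z3
      exact lt_asymm (f2 _ z4 (Or.inr rfl) z2) (f0 _ _ z4 z2 (Or.inr rfl) (Or.inl rfl))
  · have z3 := h2.resolve_left z2
    have z1 := h1.resolve_right z2
    exact lt_asymm (f3 _ z1 (Or.inl rfl) z3) (f0 _ _ z1 z3 (Or.inl rfl) (Or.inr rfl))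

theorem IsZVLineGraph.isIntervalIn_ball {α : Type} {G : SimpleGraph α} {P : ZVPartition G}
    (h : IsZVLineGraph P) :
    (∀ z ∈ P.Z, IsIntervalIn P.ord P.Z (ball G z 1 ∩ (P.Z : Set α))) ∧
      ∀ i, IsIntervalIn P.ord P.Z (ball G (P.root i) 1 ∩ (P.Z : Set α)) := by
  cases h with
  | mk _ hb _ _ _ hballroot => exact ⟨hb, hballroot⟩

/-- The cycle `C₅` is not a ZV-line graph: there is no
ZV-ordered partition ⟨Z, V₁, …, V_k⟩ (with an order on `Z`) w.r.t. which `C₅` is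
a ZV-line graph. -/
theorem C5_not_ZVLine :
    ¬ ∃ P : ZVPartition (cycleG 5), IsZVLineGraph P := by
  rintro ⟨P, hP⟩
  obtain ⟨hZ, hR⟩ := hP.isIntervalIn_ball
  refine not_forall_isIntervalIn_ball_cycleG_five P.hconn P.Z P.Z_nonempty P.ord
    P.mem_Z_or_mem_Z_cycleG_five fun x => ?_
  rcases P.cover x with hx | ⟨i, hi⟩
  · exact hZ x hx
  · rw [P.eq_root_of_mem_cycleG_five hi]
    exact hR i
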